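/- For every odd integer m > 1, δ(m−2, m, m+2) = 3m³ − 19m + 3; that is, the dual variety of the weighted projective plane ℙ(m−2, m, m+2) has degree 3m³ − 19m + 3. -/

import Mathlib

/-- Hirzebruch–Jung continued fraction expansion of `d/k`. -/
def hjList (d k : ℕ) : List ℕ :=
  if h : k ≤ 1 then [d]
  else
    (d + k - 1) / k :: hjList k ((d + k - 1) / k * k - d)
termination_by k
decreasing_by
  have h1 : (d + k - 1) / k * k ≤ d + k - 1 := Nat.div_mul_le_self _ _
  omega

/-- `Σᵢ (2 − bᵢ)` where `d/k = [b₁,…,b_r]⁻` is the Hirzebruch–Jung expansion. -/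
def hjEu (d k : ℕ) : ℤ := ((hjList d k).map (fun b => 2 - (b : ℤ))).sum

lemma hjEu_base (d k : ℕ) (h : k ≤ 1) : hjEu d k = 2 - (d : ℤ) := by
  unfold hjEu
  rw [hjList]
  simp [h]

lemma hjEu_step (d k q r : ℕ) (h : 1 < k) (hq : d + r = q * k) (hr : r < k) :
    hjEu d k = (2 - (q : ℤ)) + hjEu k r := by
  have e : (d + k - 1) / k = q := by
    rw [Nat.div_eq_iff (by omega)]
    omega
  unfold hjEu
  rw [hjList]
  have h' : ¬ k ≤ 1 := by omega
  have e2 : q * k - d = r := by omega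
  simp [h', e, e2]

lemma hjEu_two (k : ℕ) : hjEu (k + 2) (k + 1) = 0 := by
  induction k with
  | zero => rw [hjEu_base _ _ (by omega)]; norm_num
  | succ k ih =>
    rw [hjEu_step (k + 1 + 2) (k + 1 + 1) 2 (k + 1) (by omega) (by omega) (by omega), ih]
    norm_num

lemma hjEu_half (j : ℕ) : hjEu (2 * j + 1) (j + 1) = 1 - (j : ℤ) := by
  rcases j with _ | j
  · rw [hjEu_base _ _ (by omega)]; norm_num
  · rw [hjEu_step _ _ 2 1 (by omega) (by omega) (by omega), hjEu_base _ _ (by omega)]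
    push_cast; ring

lemma hjEu_by_two (j : ℕ) : hjEu (2 * j + 5) 2 = -1 - (j : ℤ) := by
  rw [hjEu_step _ _ (j + 3) 1 (by omega) (by omega) (by omega), hjEu_base _ _ (by omega)]
  push_cast; ring

lemma min_unique (P : ℕ → Prop) (a x : ℕ) (ha : P a) (hmin : ∀ y < a, ¬ P y)
    (hx : P x) (hlt : ∀ y < x, ¬ P y) : a = x := by
  rcases lt_trichotomy a x with h | h | h
  · exact absurd ha (hlt a h)
  · exact h
  · exact absurd hx (hmin x h)

/-- for odd `m > 1`, the dual variety of `ℙ(m−2, m, m+2)` has degree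
`3m³ − 19m + 3`; stated via the Matsui–Takeuchi degree formula with weights
`(K,M,N) = (m−2, m, m+2)`. -/
theorem deg_dual_wpp_odd_gap_two (m : ℕ) (hodd : Odd m) (hm : 1 < m) (a b c : ℕ)
    (ha : (m - 2) ∣ (m + a * (m + 2)))
    (hamin : ∀ a' < a, ¬ (m - 2) ∣ (m + a' * (m + 2)))
    (hb : m ∣ ((m + 2) + b * (m - 2)))
    (hbmin : ∀ b' < b, ¬ m ∣ ((m + 2) + b' * (m - 2)))
    (hc : (m + 2) ∣ ((m - 2) + c * m))
    (hcmin : ∀ c' < c, ¬ (m + 2) ∣ ((m - 2) + c' * m)) :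
    3 * ((m - 2 : ℕ) : ℤ) * (m : ℤ) * ((m : ℤ) + 2)
        - 2 * (((m - 2 : ℕ) : ℤ) + (m : ℤ) + ((m : ℤ) + 2))
        + hjEu (m - 2) ((m - 2) - a) + hjEu m (m - b) + hjEu (m + 2) ((m + 2) - c)
      = 3 * (m : ℤ) ^ 3 - 19 * (m : ℤ) + 3 := by
  obtain ⟨i, rfl⟩ := hodd
  obtain ⟨j, rfl⟩ : ∃ j, i = j + 1 := ⟨i - 1, by omega⟩
  have e1 : 2 * (j + 1) + 1 - 2 = 2 * j + 1 := by omega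
  rw [e1] at *
  have hA : a = j := by
    refine min_unique (fun a => (2 * j + 1) ∣ (2 * (j + 1) + 1 + a * (2 * (j + 1) + 1 + 2)))
      a j ha hamin ⟨j + 3, by ring⟩ ?_
    intro y hy hd
    have h2 : (2 * j + 1) ∣ 2 * (2 * y + 1) := by
      have h3 : 2 * (j + 1) + 1 + y * (2 * (j + 1) + 1 + 2)
        = (2 * j + 1) * (y + 1) + 2 * (2 * y + 1) := by ring
      rw [h3] at hd
      exact (Nat.dvd_add_right (dvd_mul_right _ _)).1 hd
    have hco : Nat.Coprime (2 * j + 1) 2 := by simp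
    have := Nat.le_of_dvd (by omega) (hco.dvd_of_dvd_mul_left h2)
    omega
  have hB : b = 1 := by
    refine min_unique (fun b => (2 * (j + 1) + 1) ∣ (2 * (j + 1) + 1 + 2 + b * (2 * j + 1)))
      b 1 hb hbmin ⟨2, by ring⟩ ?_
    intro y hy hd
    obtain rfl : y = 0 := by omega
    have h2 : (2 * (j + 1) + 1) ∣ 2 := by
      have h3 : 2 * (j + 1) + 1 + 2 + 0 * (2 * j + 1) = (2 * (j + 1) + 1) + 2 := by ring
      simp only [h3] at hd
      exact (Nat.dvd_add_right (dvd_refl _)).1 hd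
    have := Nat.le_of_dvd (by omega) h2
    omega
  have hC : c = 2 * j + 3 := by
    refine min_unique (fun c => (2 * (j + 1) + 1 + 2) ∣ (2 * j + 1 + c * (2 * (j + 1) + 1)))
      c (2 * j + 3) hc hcmin ⟨2 * j + 2, by ring⟩ ?_
    intro y hy hd
    have h2 : (2 * (j + 1) + 1 + 2) ∣ 2 * (y + 2) := by
      have h3 : (2 * j + 1 + y * (2 * (j + 1) + 1)) + 2 * (y + 2)
        = (2 * (j + 1) + 1 + 2) * (y + 1) := by ring
      refine (Nat.dvd_add_right hd).1 ?_
      rw [h3]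
      exact dvd_mul_right _ _
    have hco : Nat.Coprime (2 * (j + 1) + 1 + 2) 2 := by
      rw [show 2 * (j + 1) + 1 + 2 = 2 * (j + 2) + 1 by ring]; simp
    have := Nat.le_of_dvd (by omega) (hco.dvd_of_dvd_mul_left h2)
    omega
  subst hA hB hC
  rw [show 2 * a + 1 - a = a + 1 by omega, hjEu_half,
    show 2 * (a + 1) + 1 - 1 = (2 * a + 1) + 1 by omega,
    show 2 * (a + 1) + 1 = (2 * a + 1) + 2 by omega, hjEu_two,
    show 2 * a + 1 + 2 + 2 - (2 * a + 3) = 2 by omega,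
    show 2 * a + 1 + 2 + 2 = 2 * a + 5 by omega, hjEu_by_two]
  push_cast
  ring
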